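/- arXiv:1506.04847 — 2 statements merged into one kernel-verified Lean document; each statement's English description precedes it below -/
import Mathlib

section
/- There exists a module (Φ,χ)-mean on 𝒜* if and only if there exists a bounded net (a_j) in 𝒜 such that (χ∘Φ)(a_j) = 1 for every j and, for all a ∈ 𝒜 and α ∈ 𝔄, ‖a a_j − (χ∘Φ)(a) a_j‖ → 0 and ‖α·a_j − χ(α) a_j‖ → 0. -/
open Filter Topology ContinuousLinearMap

/-- A net in `E`: a family indexed by a nonempty directed (sup-semilattice) index type. -/
structure Net (E : Type*) where
  ι : Type
  dir : SemilatticeSup ι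
  ne : Nonempty ι
  toFun : ι → E

/-- Convergence of the image of a net under `f` to a point `x`. -/
def Net.Tendsto {E X : Type*} [TopologicalSpace X] (n : Net E) (f : E → X) (x : X) : Prop :=
  letI := n.dir
  letI := n.ne
  Filter.Tendsto (fun j => f (n.toFun j)) Filter.atTop (nhds x)

/-- A net is bounded if it is norm-bounded. -/
def Net.Bounded {E : Type*} [Norm E] (n : Net E) : Prop :=
  ∃ C : ℝ, ∀ j, ‖n.toFun j‖ ≤ C

variable (𝔄 𝒜 : Type) [NonUnitalNormedRing 𝔄] [NormedSpace ℂ 𝔄]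
  [NonUnitalNormedRing 𝒜] [NormedSpace ℂ 𝒜]

/-- Compatible bounded (bilinear) `𝔄`-bimodule actions on the Banach algebra `𝒜`:
`α·(ab) = (α·a)b`, `(ab)·α = a(b·α)`, together with the `𝔄`-bimodule axioms. -/
structure CompatibleActions : Type where
  l : 𝔄 →L[ℂ] 𝒜 →L[ℂ] 𝒜
  r : 𝒜 →L[ℂ] 𝔄 →L[ℂ] 𝒜
  l_mul_l : ∀ α β a, l (α * β) a = l α (l β a)
  r_mul_r : ∀ a α β, r (r a α) β = r a (α * β)
  l_r_comm : ∀ α a β, r (l α a) β = l α (r a β)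
  compat_l : ∀ α a b, l α (a * b) = l α a * b
  compat_r : ∀ a b α, r (a * b) α = a * r b α

variable {𝔄 𝒜}

/-- `χ` is a character of `𝔄`: a nonzero multiplicative bounded linear functional. -/
def IsCharacter (χ : 𝔄 →L[ℂ] ℂ) : Prop :=
  χ ≠ 0 ∧ ∀ α β, χ (α * β) = χ α * χ β

/-- `Φ : 𝒜 → 𝔄` is multiplicative and satisfies `Φ(a·α) = Φ(α·a) = χ(α)Φ(a)`. -/
def IsModuleHom (act : CompatibleActions 𝔄 𝒜) (χ : 𝔄 →L[ℂ] ℂ) (Φ : 𝒜 →L[ℂ] 𝔄) : Prop :=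
  (∀ a b, Φ (a * b) = Φ a * Φ b) ∧
  (∀ a α, Φ (act.r a α) = χ α • Φ a) ∧
  (∀ α a, Φ (act.l α a) = χ α • Φ a)

/-- If the real part of `h` is at most `u` on the ball of radius `M`, then `M * ‖h‖ ≤ u`. -/
theorem ContinuousLinearMap.mul_norm_le_of_re_le {E : Type*} [NormedAddCommGroup E]
    [NormedSpace ℂ E] (h : E →L[ℂ] ℂ) {M u : ℝ} (hM : 0 < M)
    (H : ∀ a, ‖a‖ ≤ M → (h a).re ≤ u) : M * ‖h‖ ≤ u := by
  have hu : 0 ≤ u := by simpa using H 0 (by simpa using hM.le)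
  have hball : ∀ a, ‖a‖ ≤ M → ‖h a‖ ≤ u := by
    intro a ha
    by_cases h0 : h a = 0
    · simpa [h0] using hu
    have hc : ‖(‖h a‖ : ℂ) / h a‖ = 1 := by simp [h0]
    have := H (((‖h a‖ : ℂ) / h a) • a) (by rw [norm_smul, hc, one_mul]; exact ha)
    rwa [map_smul, smul_eq_mul, div_mul_cancel₀ _ h0, Complex.ofReal_re] at this
  have : ‖h‖ ≤ u / M := by
    refine h.opNorm_le_bound (by positivity) fun a => ?_
    refine LinearMap.bound_of_ball_bound' hM u h.toLinearMap (fun z hz => hball z ?_) a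
    simpa using hz
  rw [le_div_iff₀ hM] at this
  linarith

/-- If a functional `m` on the dual of `E` annihilates the range of the adjoint of `D` and takes
the value `1` at `φ`, then `D` has approximate zeros on a bounded part of `φ = 1`. -/
theorem exists_norm_lt_of_bidual {E G : Type*} [NormedAddCommGroup E] [NormedSpace ℂ E]
    [NormedAddCommGroup G] [NormedSpace ℂ G] (m : (E →L[ℂ] ℂ) →L[ℂ] ℂ) (φ : E →L[ℂ] ℂ)
    (D : E →L[ℂ] G) (hφ : m φ = 1) (hD : ∀ g : G →L[ℂ] ℂ, m (g.comp D) = 0)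
    {ε : ℝ} (hε : 0 < ε) : ∃ a, ‖a‖ ≤ 2 * ‖m‖ ∧ φ a = 1 ∧ ‖D a‖ < ε := by
  have hM : 0 < ‖m‖ := by
    have h := m.le_opNorm φ
    rw [hφ, norm_one] at h
    exact pos_of_mul_pos_left (zero_lt_one.trans_le h) (norm_nonneg φ)
  have key : ((1 : ℂ), (0 : G)) ∈ closure (φ.prod D '' Metric.closedBall 0 ‖m‖) := by
    by_contra hcon
    have hconv : Convex ℝ (closure (φ.prod D '' Metric.closedBall 0 ‖m‖)) :=
      ((convex_closedBall (0 : E) ‖m‖).linear_image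
        ((φ.prod D).toLinearMap.restrictScalars ℝ)).closure
    obtain ⟨g, u, hg, hu⟩ := RCLike.geometric_hahn_banach_closed_point (𝕜 := ℂ)
      hconv isClosed_closure hcon
    have hnorm := (g.comp (φ.prod D)).mul_norm_le_of_re_le (u := u) hM fun a ha =>
      (hg _ (subset_closure ⟨a, by simpa using ha, rfl⟩)).le
    have hdecomp : g.comp (φ.prod D)
        = g (1, 0) • φ + (g.comp (ContinuousLinearMap.inr ℂ ℂ G)).comp D := by
      ext a
      have : (φ a, D a) = φ a • ((1 : ℂ), (0 : G)) + (0, D a) := by simp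
      simp only [ContinuousLinearMap.comp_apply, ContinuousLinearMap.prod_apply,
        add_apply, smul_apply,
        ContinuousLinearMap.inr_apply]
      rw [this, map_add, map_smul, smul_eq_mul, smul_eq_mul, mul_comm]
    have hm : m (g.comp (φ.prod D)) = g (1, 0) := by
      rw [hdecomp, map_add, map_smul, hφ, hD]; simp
    have h1 : ‖g (1, 0)‖ ≤ u := hm ▸ (m.le_opNorm _).trans hnorm
    have h2 : u < (g (1, 0)).re := hu
    exact absurd ((Complex.re_le_norm _).trans h1) (not_le.2 h2)
  obtain ⟨_, ⟨a, ha, rfl⟩, hdist⟩ := Metric.mem_closure_iff.1 key (min (1 / 2) (ε / 2))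
    (by positivity)
  rw [dist_eq_norm, Prod.norm_def, max_lt_iff] at hdist
  simp only [ContinuousLinearMap.prod_apply, Prod.fst_sub, Prod.snd_sub, zero_sub,
    norm_neg] at hdist
  have h1 : ‖1 - φ a‖ < 1 / 2 := hdist.1.trans_le (min_le_left _ _)
  have h2 : ‖D a‖ < ε / 2 := hdist.2.trans_le (min_le_right _ _)
  have h3 : 1 / 2 < ‖φ a‖ := by
    have := norm_sub_norm_le (1 : ℂ) (φ a)
    rw [norm_one] at this
    linarith
  have h0 : φ a ≠ 0 := norm_pos_iff.1 (by linarith)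
  have hinv : ‖(φ a)⁻¹‖ ≤ 2 := by
    rw [norm_inv]
    exact inv_le_of_inv_le₀ (by norm_num) (by linarith)
  have ha' : ‖a‖ ≤ ‖m‖ := by simpa using ha
  refine ⟨(φ a)⁻¹ • a, ?_, ?_, ?_⟩
  · rw [norm_smul]; gcongr
  · rw [map_smul, smul_eq_mul, inv_mul_cancel₀ h0]
  · rw [map_smul, norm_smul]
    calc ‖(φ a)⁻¹‖ * ‖D a‖ ≤ 2 * ‖D a‖ := by gcongr
      _ < ε := by linarith

theorem exists_bounded_net_of_bidual {E ι : Type} [NormedAddCommGroup E] [NormedSpace ℂ E]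
    (m : (E →L[ℂ] ℂ) →L[ℂ] ℂ) (φ : E →L[ℂ] ℂ) (D : ι → E →L[ℂ] E) (hφ : m φ = 1)
    (hD : ∀ i (g : E →L[ℂ] ℂ), m (g.comp (D i)) = 0) :
    ∃ n : Net E, n.Bounded ∧ (∀ j, φ (n.toFun j) = 1) ∧
      ∀ i, n.Tendsto (fun x => ‖D i x‖) (0 : ℝ) := by
  classical
  have hex : ∀ p : Finset ι × ℕ, ∃ a, ‖a‖ ≤ 2 * ‖m‖ ∧ φ a = 1 ∧
      ∀ i ∈ p.1, ‖D i a‖ < 1 / ((p.2 : ℝ) + 1) := by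
    rintro ⟨F, k⟩
    obtain ⟨a, ha, ha1, haD⟩ := exists_norm_lt_of_bidual m φ
      (ContinuousLinearMap.pi fun i : F => D i) hφ (fun g => by
        have : g.comp (ContinuousLinearMap.pi fun i : F => D i)
            = ∑ i : F, (g.comp (ContinuousLinearMap.single ℂ (fun _ : F => E) i)).comp
              (D i) := by
          ext a
          simp only [ContinuousLinearMap.comp_apply, sum_apply]
          rw [← map_sum]
          congr 1
          exact (Finset.univ_sum_single (fun i : F => D i a)).symm
        rw [this, map_sum]
        exact Finset.sum_eq_zero fun i _ => hD i _)
      (Nat.one_div_pos_of_nat (α := ℝ) (n := k))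
    exact ⟨a, ha, ha1, fun i hi => (norm_le_pi_norm
      ((ContinuousLinearMap.pi fun i : F => D i) a) ⟨i, hi⟩).trans_lt haD⟩
  choose x hx hx1 hxD using hex
  refine ⟨⟨Finset ι × ℕ, inferInstance, inferInstance, x⟩, ⟨_, hx⟩, hx1, fun i => ?_⟩
  have hlim : Tendsto (fun p : Finset ι × ℕ => 1 / ((p.2 : ℝ) + 1)) atTop (𝓝 0) := by
    rw [← prod_atTop_atTop_eq]
    exact (tendsto_one_div_add_atTop_nhds_zero_nat (𝕜 := ℝ)).comp tendsto_snd
  refine squeeze_zero' (.of_forall fun _ => norm_nonneg _) ?_ hlim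
  filter_upwards [eventually_ge_atTop (({i}, 0) : Finset ι × ℕ)] with p hp
  exact (hxD p i (hp.1 (Finset.mem_singleton_self i))).le

/-- A bounded net has a weak-star cluster point in the bidual. -/
theorem Net.Bounded.exists_bidual_limit {E : Type*} [NormedAddCommGroup E] [NormedSpace ℂ E]
    {n : Net E} (hn : n.Bounded) :
    ∃ (U : Filter n.ι) (m : (E →L[ℂ] ℂ) →L[ℂ] ℂ), U.NeBot ∧
      (∀ f : E →L[ℂ] ℂ, Filter.Tendsto (fun j => f (n.toFun j)) U (𝓝 (m f))) ∧
      ∀ (F : E → ℝ) (y : ℝ), n.Tendsto F y →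
        Filter.Tendsto (fun j => F (n.toFun j)) U (𝓝 y) := by
  let _ := n.dir
  let _ := n.ne
  obtain ⟨C, hC⟩ := hn
  let U : Ultrafilter n.ι := Ultrafilter.of atTop
  have hb : ∀ f : E →L[ℂ] ℂ, ∃ z ∈ Metric.closedBall (0 : ℂ) (C * ‖f‖),
      Filter.Tendsto (fun j => f (n.toFun j)) U (𝓝 z) := fun f =>
    (isCompact_closedBall (0 : ℂ) (C * ‖f‖)).ultrafilter_le_nhds
      (U.map fun j => f (n.toFun j)) (by
        refine le_principal_iff.2 (Filter.mem_map.2 (Filter.univ_mem' fun j => ?_))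
        rw [Set.mem_preimage, mem_closedBall_zero_iff, mul_comm]
        exact (f.le_opNorm _).trans (by gcongr; exact hC j))
  choose m hm hlim using hb
  refine ⟨U, LinearMap.mkContinuous
    { toFun := m
      map_add' := fun f g => tendsto_nhds_unique (hlim (f + g)) ((hlim f).add (hlim g))
      map_smul' := fun c f =>
        tendsto_nhds_unique (hlim (c • f)) ((hlim f).const_mul c) } C
      (fun f => by simpa using hm f), inferInstance, hlim,
    fun F y h => h.mono_left (Ultrafilter.of_le _)⟩

theorem tendsto_apply_sub_smul_unique {E J : Type*} [NormedAddCommGroup E] [NormedSpace ℂ E]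
    {U : Filter J} [U.NeBot] {x : J → E} {T : E →L[ℂ] E} {c y z : ℂ} (f : E →L[ℂ] ℂ)
    (hT : Tendsto (fun j => ‖T (x j) - c • x j‖) U (𝓝 0))
    (hy : Tendsto (fun j => f (x j)) U (𝓝 y)) (hz : Tendsto (fun j => f (T (x j))) U (𝓝 z)) :
    z = c * y := by
  have h := (f.continuous.tendsto 0).comp (tendsto_zero_iff_norm_tendsto_zero.2 hT)
  rw [map_zero] at h
  refine sub_eq_zero.1 (tendsto_nhds_unique (hz.sub (hy.const_mul c)) (h.congr fun j => ?_))
  simp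

/-- **Theorem (module means).** There exists a module `(Φ,χ)`-mean on `𝒜*` — a bounded linear
functional `m : 𝒜* → ℂ` with `m(f·a) = (χ∘Φ)(a) m(f)`, `m(f·α) = χ(α) m(f)` and `m(χ∘Φ) = 1`,
where `(f·a)(b) = f(ab)` and `(f·α)(b) = f(α·b)` — if and only if there is a bounded net
`(a_j)` in `𝒜` with `(χ∘Φ)(a_j) = 1` for all `j`, `‖a a_j - (χ∘Φ)(a) a_j‖ → 0` and
`‖α·a_j - χ(α) a_j‖ → 0` for all `a ∈ 𝒜`, `α ∈ 𝔄`. -/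
theorem exists_module_mean_iff_bounded_net
    {𝔄 𝒜 : Type} [NonUnitalNormedRing 𝔄] [NormedSpace ℂ 𝔄] [CompleteSpace 𝔄]
    [NonUnitalNormedRing 𝒜] [NormedSpace ℂ 𝒜] [CompleteSpace 𝒜]
    [SMulCommClass ℂ 𝒜 𝒜] [IsScalarTower ℂ 𝒜 𝒜]
    (act : CompatibleActions 𝔄 𝒜) (χ : 𝔄 →L[ℂ] ℂ) (hχ : IsCharacter χ)
    (Φ : 𝒜 →L[ℂ] 𝔄) (hΦ : IsModuleHom act χ Φ) :
    (∃ m : (𝒜 →L[ℂ] ℂ) →L[ℂ] ℂ,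
        (∀ (f : 𝒜 →L[ℂ] ℂ) (a : 𝒜),
          m (f.comp (ContinuousLinearMap.mul ℂ 𝒜 a)) = χ (Φ a) * m f) ∧
        (∀ (f : 𝒜 →L[ℂ] ℂ) (α : 𝔄), m (f.comp (act.l α)) = χ α * m f) ∧
        m (χ.comp Φ) = 1) ↔
      ∃ n : Net 𝒜, n.Bounded ∧ (∀ j, χ (Φ (n.toFun j)) = 1) ∧
        (∀ a : 𝒜, n.Tendsto (fun x => ‖a * x - χ (Φ a) • x‖) (0 : ℝ)) ∧
        (∀ α : 𝔄, n.Tendsto (fun x => ‖act.l α x - χ α • x‖) (0 : ℝ)) := by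
  constructor
  · rintro ⟨m, hm1, hm2, hm3⟩
    obtain ⟨n, hn, hn1, hnD⟩ := exists_bounded_net_of_bidual m (χ.comp Φ)
      (Sum.elim (fun a => ContinuousLinearMap.mul ℂ 𝒜 a - χ (Φ a) • .id ℂ 𝒜)
        (fun α => act.l α - χ α • .id ℂ 𝒜)) hm3 (by
        rintro (a | α) g
        · simp [ContinuousLinearMap.comp_sub, hm1]
        · simp [ContinuousLinearMap.comp_sub, hm2])
    exact ⟨n, hn, hn1, fun a => hnD (.inl a), fun α => hnD (.inr α)⟩
  · rintro ⟨n, hn, hn1, hna, hnα⟩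
    obtain ⟨U, m, hU, hm, hUn⟩ := hn.exists_bidual_limit
    refine ⟨m, fun f a => ?_, fun f α => ?_, ?_⟩
    · exact tendsto_apply_sub_smul_unique (T := ContinuousLinearMap.mul ℂ 𝒜 a) f
        (hUn _ _ (hna a)) (hm f) (hm _)
    · exact tendsto_apply_sub_smul_unique (T := act.l α) f (hUn _ _ (hnα α)) (hm f) (hm _)
    · exact tendsto_nhds_unique (hm (χ.comp Φ)) (tendsto_const_nhds.congr fun j => (hn1 j).symm)
end

section
/- Suppose ℐ has a right identity (an element e ∈ ℐ with xe = x for all x ∈ ℐ) and 𝒜/ℐ has a module (Φ̃,χ̃)-mean in 𝒜/ℐ itself. Then 𝒜 has a module (Φ,χ)-mean in 𝒜 itself; indeed, if m ∈ 𝒜 is any element whose image in 𝒜/ℐ is such a mean, then m − me is a module (Φ,χ)-mean in 𝒜. -/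
open Filter Topology ContinuousLinearMap

variable (𝔄 𝒜 : Type) [NonUnitalNormedRing 𝔄] [NormedSpace ℂ 𝔄]
  [NonUnitalNormedRing 𝒜] [NormedSpace ℂ 𝒜]

variable {𝔄 𝒜}

/-- Scalars can be pulled out of products whose left factor lies in the range of the action. -/
theorem CompatibleActions.smul_l_mul (act : CompatibleActions 𝔄 𝒜) (c : ℂ) (α : 𝔄) (a b : 𝒜) :
    (c • act.l α a) * b = c • (act.l α a * b) := by
  have h := act.compat_l (c • α) a b
  simp only [map_smul, _root_.smul_apply] at h
  rw [← h, act.compat_l]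

/-- A character attains the value one. -/
theorem IsCharacter.exists_eq_one {χ : 𝔄 →L[ℂ] ℂ} (hχ : IsCharacter χ) : ∃ α, χ α = 1 := by
  obtain ⟨β, hβ⟩ := DFunLike.ne_iff.mp hχ.1
  refine ⟨(χ β)⁻¹ • β, ?_⟩
  rw [map_smul, smul_eq_mul]
  exact inv_mul_cancel₀ hβ

/-- If `m` agrees with `α·m` modulo a subspace with right identity `e`, then right
multiplication of `m` by `e` commutes with scalars. -/
theorem CompatibleActions.smul_mul_rightIdentity (act : CompatibleActions 𝔄 𝒜)
    {I : Submodule ℂ 𝒜} {e : 𝒜} (heid : ∀ x ∈ I, x * e = x) {α : 𝔄} {m : 𝒜}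
    (hm : act.l α m - m ∈ I) (c : ℂ) : (c • m) * e = c • (m * e) := by
  have h₁ := heid _ hm
  have h₂ := heid _ (I.smul_mem c hm)
  rw [smul_sub, sub_mul, act.smul_l_mul, ← smul_sub] at h₂
  rw [sub_mul] at h₁
  rw [← h₁, smul_sub] at h₂
  exact sub_right_injective h₂

/-- **Proposition 3.5.** Let `ℐ ⊆ ker Φ` be a closed two-sided ideal of `𝒜` which is an
`𝔄`-sub-bimodule, and `𝔍 ⊆ ker χ` a closed two-sided ideal of `𝔄` with `𝔍·𝒜 ⊆ ℐ` and
`𝒜·𝔍 ⊆ ℐ`.  If `ℐ` has a right identity `e` and `m ∈ 𝒜` has the property that its image in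
`𝒜/ℐ` is a module `(Φ̃,χ̃)`-mean in `𝒜/ℐ` (expressed by the coset conditions `hm₁`–`hm₃`),
then `m - m e` is a module `(Φ,χ)`-mean in `𝒜` itself. -/
theorem quotient_mean_lifts
    {𝔄 𝒜 : Type} [NonUnitalNormedRing 𝔄] [NormedSpace ℂ 𝔄] [CompleteSpace 𝔄]
    [NonUnitalNormedRing 𝒜] [NormedSpace ℂ 𝒜] [CompleteSpace 𝒜]
    (act : CompatibleActions 𝔄 𝒜) (χ : 𝔄 →L[ℂ] ℂ) (hχ : IsCharacter χ)
    (Φ : 𝒜 →L[ℂ] 𝔄) (hΦ : IsModuleHom act χ Φ)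
    -- the ideal `ℐ`
    (I : Submodule ℂ 𝒜) (hIclosed : IsClosed (I : Set 𝒜))
    (hImull : ∀ a : 𝒜, ∀ x ∈ I, a * x ∈ I) (hImulr : ∀ a : 𝒜, ∀ x ∈ I, x * a ∈ I)
    (hIactl : ∀ α : 𝔄, ∀ x ∈ I, act.l α x ∈ I) (hIactr : ∀ x ∈ I, ∀ α : 𝔄, act.r x α ∈ I)
    (hIker : ∀ x ∈ I, Φ x = 0)
    -- the ideal `𝔍`
    (J : Submodule ℂ 𝔄) (hJclosed : IsClosed (J : Set 𝔄))
    (hJmull : ∀ α : 𝔄, ∀ β ∈ J, α * β ∈ J) (hJmulr : ∀ α : 𝔄, ∀ β ∈ J, β * α ∈ J)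
    (hJker : ∀ β ∈ J, χ β = 0)
    (hJI : ∀ β ∈ J, ∀ a : 𝒜, act.l β a ∈ I) (hIJ : ∀ a : 𝒜, ∀ β ∈ J, act.r a β ∈ I)
    -- `e` is a right identity for `ℐ`
    (e : 𝒜) (he : e ∈ I) (heid : ∀ x ∈ I, x * e = x)
    -- the image of `m` in `𝒜/ℐ` is a module `(Φ̃,χ̃)`-mean in `𝒜/ℐ` itself
    (m : 𝒜)
    (hm₁ : ∀ a : 𝒜, a * m - χ (Φ a) • m ∈ I)
    (hm₂ : ∀ α : 𝔄, act.l α m - χ α • m ∈ I)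
    (hm₃ : χ (Φ m) = 1) :
    -- `m - m e` is a module `(Φ,χ)`-mean in `𝒜` itself
    (∀ a : 𝒜, a * (m - m * e) = χ (Φ a) • (m - m * e)) ∧
    (∀ α : 𝔄, act.l α (m - m * e) = χ α • (m - m * e)) ∧
    χ (Φ (m - m * e)) = 1 := by
  obtain ⟨α₀, hα₀⟩ := hχ.exists_eq_one
  have hsmul : ∀ c : ℂ, (c • m) * e = c • (m * e) :=
    act.smul_mul_rightIdentity heid (α := α₀) (by simpa [hα₀] using hm₂ α₀)
  refine ⟨fun a => ?_, fun α => ?_, ?_⟩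
  · have h := heid _ (hm₁ a)
    rw [sub_mul, hsmul] at h
    rw [mul_sub, smul_sub, ← mul_assoc, sub_eq_sub_iff_sub_eq_sub]
    exact h.symm
  · have h := heid _ (hm₂ α)
    rw [sub_mul, hsmul] at h
    rw [map_sub, act.compat_l, smul_sub, sub_eq_sub_iff_sub_eq_sub]
    exact h.symm
  · rw [map_sub, hIker _ (hImull m e he), sub_zero, hm₃]
end
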